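/- For every ε > 0 and every β > 0 one has I_{[1,1]}(ε;β) ≤ I_GL(ε). If moreover β ≥ 1, then I_{[1,1]}(ε;β) = I_GL(ε). -/

import Mathlib

open MeasureTheory Metric Set Filter Complex

noncomputable section

/-- Sum of squared norms of the two first-order partial derivatives (plane identified with `ℂ`). -/
def gradSq (f : ℂ → ℂ) (x : ℂ) : ℝ :=
  ‖fderiv ℝ f x 1‖ ^ 2 + ‖fderiv ℝ f x Complex.I‖ ^ 2

/-- Two-component Ginzburg–Landau energy density on the unit disk. -/
def eDen (ε β : ℝ) (ψp ψm : ℂ → ℂ) (x : ℂ) : ℝ :=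
  (1 / 2) * (gradSq ψp x + gradSq ψm x)
    + (1 / (4 * ε ^ 2)) * ((‖ψp x‖ ^ 2 + ‖ψm x‖ ^ 2 - 1) ^ 2)
    + (β / (4 * ε ^ 2)) * ((‖ψp x‖ ^ 2 - ‖ψm x‖ ^ 2) ^ 2)

/-- Two-component Ginzburg–Landau energy on the unit disk. -/
def En (ε β : ℝ) (ψp ψm : ℂ → ℂ) : ℝ := ∫ x in ball (0 : ℂ) 1, eDen ε β ψp ψm x

/-- Scalar Ginzburg–Landau energy density. -/
def gDen (ε : ℝ) (u : ℂ → ℂ) (x : ℂ) : ℝ :=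
  (1 / 2) * gradSq u x + (1 / (4 * ε ^ 2)) * ((1 - ‖u x‖ ^ 2) ^ 2)

/-- Scalar Ginzburg–Landau energy on the unit disk. -/
def Gn (ε : ℝ) (u : ℂ → ℂ) : ℝ := ∫ x in ball (0 : ℂ) 1, gDen ε u x

/-- Admissible two-component map with boundary degrees `(np, nm)`. -/
def AdmissiblePair (ε β : ℝ) (np nm : ℕ) (ψp ψm : ℂ → ℂ) : Prop :=
  ContinuousOn ψp (closedBall 0 1) ∧ ContinuousOn ψm (closedBall 0 1) ∧
  ContDiffOn ℝ 1 ψp (ball 0 1) ∧ ContDiffOn ℝ 1 ψm (ball 0 1) ∧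
  IntegrableOn (eDen ε β ψp ψm) (ball 0 1) ∧
  ∀ x : ℂ, ‖x‖ = 1 →
    ψp x = (Real.sqrt 2 : ℂ)⁻¹ * x ^ np ∧ ψm x = (Real.sqrt 2 : ℂ)⁻¹ * x ^ nm

/-- The infimum `I_{[np,nm]}(ε;β)`. -/
def Ival (ε β : ℝ) (np nm : ℕ) : ℝ :=
  sInf { e : ℝ | ∃ ψp ψm : ℂ → ℂ, AdmissiblePair ε β np nm ψp ψm ∧ e = En ε β ψp ψm }

/-- Admissible scalar map with degree-one boundary condition. -/
def AdmissibleScalar (ε : ℝ) (u : ℂ → ℂ) : Prop :=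
  ContinuousOn u (closedBall 0 1) ∧ ContDiffOn ℝ 1 u (ball 0 1) ∧
  IntegrableOn (gDen ε u) (ball 0 1) ∧ ∀ x : ℂ, ‖x‖ = 1 → u x = x

/-- The infimum `I_GL(ε)`. -/
def IGL (ε : ℝ) : ℝ :=
  sInf { e : ℝ | ∃ u : ℂ → ℂ, AdmissibleScalar ε u ∧ e = Gn ε u }

/-- Spin of a two-component map. -/
def spin (ψp ψm : ℂ → ℂ) (x : ℂ) : ℝ := (1 / 2) * (‖ψm x‖ ^ 2 - ‖ψp x‖ ^ 2)

theorem gradSq_const_mul (c : ℂ) (f : ℂ → ℂ) (x : ℂ) :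
    gradSq (fun y => c * f y) x = ‖c‖ ^ 2 * gradSq f x := by
  have h : fderiv ℝ (fun y => c * f y) x = c • fderiv ℝ f x :=
    congrFun (fderiv_const_smul_field (𝕜 := ℝ) (f := f) c) x
  simp only [gradSq, h, _root_.smul_apply, smul_eq_mul, norm_mul]
  ring

theorem gradSq_nonneg (f : ℂ → ℂ) (x : ℂ) : 0 ≤ gradSq f x := by
  unfold gradSq; positivity

theorem gDen_nonneg (ε : ℝ) (u : ℂ → ℂ) (x : ℂ) : 0 ≤ gDen ε u x := by
  have := gradSq_nonneg u x
  unfold gDen; positivity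

theorem eDen_nonneg {ε β : ℝ} (hβ : 0 ≤ β) (ψp ψm : ℂ → ℂ) (x : ℂ) :
    0 ≤ eDen ε β ψp ψm x := by
  have := gradSq_nonneg ψp x
  have := gradSq_nonneg ψm x
  unfold eDen; positivity

theorem norm_ofReal_sqrt_two_sq : ‖(Real.sqrt 2 : ℂ)‖ ^ 2 = 2 := by
  simp [Complex.norm_real]

theorem ofReal_sqrt_two_ne_zero : (Real.sqrt 2 : ℂ) ≠ 0 := by
  simp

/-- Splitting a scalar map equally between the two components preserves the energy density. -/
theorem eDen_split (ε β : ℝ) (u : ℂ → ℂ) :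
    eDen ε β (fun y => (Real.sqrt 2 : ℂ)⁻¹ * u y) (fun y => (Real.sqrt 2 : ℂ)⁻¹ * u y)
      = gDen ε u := by
  funext x
  simp only [eDen, gDen, gradSq_const_mul, norm_mul, norm_inv, mul_pow, inv_pow,
    norm_ofReal_sqrt_two_sq]
  ring

/-- For `β = 1` the two-component density decouples into two scalar densities; larger `β` only
increases it. -/
theorem average_gDen_le_eDen {ε β : ℝ} (hβ : 1 ≤ β) (ψp ψm : ℂ → ℂ) (x : ℂ) :
    (1 / 2) * (gDen ε (fun y => (Real.sqrt 2 : ℂ) * ψp y) x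
      + gDen ε (fun y => (Real.sqrt 2 : ℂ) * ψm y) x) ≤ eDen ε β ψp ψm x := by
  simp only [eDen, gDen, gradSq_const_mul, norm_mul, mul_pow, norm_ofReal_sqrt_two_sq]
  have h : 0 ≤ ((β - 1) / (4 * ε ^ 2)) * ((‖ψp x‖ ^ 2 - ‖ψm x‖ ^ 2) ^ 2) := by
    have : 0 ≤ β - 1 := by linarith
    positivity
  simp only [sub_div, sub_mul] at h
  nlinarith [h]

theorem continuousOn_gDen (ε : ℝ) {u : ℂ → ℂ} {s : Set ℂ} (hs : IsOpen s)
    (hu : ContDiffOn ℝ 1 u s) : ContinuousOn (gDen ε u) s := by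
  have hc : ContinuousOn u s := hu.continuousOn
  have hd : ContinuousOn (fderiv ℝ u) s := hu.continuousOn_fderiv_of_isOpen hs le_rfl
  have h1 : ContinuousOn (fun x => fderiv ℝ u x 1) s := hd.clm_apply continuousOn_const
  have h2 : ContinuousOn (fun x => fderiv ℝ u x Complex.I) s := hd.clm_apply continuousOn_const
  unfold gDen gradSq
  fun_prop

theorem AdmissibleScalar.split {ε : ℝ} {u : ℂ → ℂ} (hu : AdmissibleScalar ε u) (β : ℝ) :
    AdmissiblePair ε β 1 1 (fun y => (Real.sqrt 2 : ℂ)⁻¹ * u y)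
      (fun y => (Real.sqrt 2 : ℂ)⁻¹ * u y) := by
  obtain ⟨hc, hd, hi, hb⟩ := hu
  have hc' := continuousOn_const (c := (Real.sqrt 2 : ℂ)⁻¹).mul hc
  have hd' : ContDiffOn ℝ 1 (fun y => (Real.sqrt 2 : ℂ)⁻¹ * u y) (ball 0 1) :=
    contDiffOn_const.mul hd
  refine ⟨hc', hc', hd', hd', ?_, fun x hx => ?_⟩
  · rwa [eDen_split]
  · simp [hb x hx]

/-- A component of an admissible pair, rescaled by `√2`, is an admissible scalar map as soon as
half of its energy density is controlled by an integrable function. -/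
theorem admissibleScalar_of_le {ε : ℝ} {ψ : ℂ → ℂ} {F : ℂ → ℝ}
    (hc : ContinuousOn ψ (closedBall 0 1)) (hd : ContDiffOn ℝ 1 ψ (ball 0 1))
    (hF : IntegrableOn F (ball 0 1))
    (hle : ∀ x, (1 / 2) * gDen ε (fun y => (Real.sqrt 2 : ℂ) * ψ y) x ≤ F x)
    (hb : ∀ x : ℂ, ‖x‖ = 1 → ψ x = (Real.sqrt 2 : ℂ)⁻¹ * x ^ 1) :
    AdmissibleScalar ε (fun y => (Real.sqrt 2 : ℂ) * ψ y) := by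
  have hd' : ContDiffOn ℝ 1 (fun y => (Real.sqrt 2 : ℂ) * ψ y) (ball 0 1) :=
    contDiffOn_const.mul hd
  refine ⟨continuousOn_const.mul hc, hd', ?_, fun x hx => ?_⟩
  · refine Integrable.mono' (hF.const_mul 2)
      ((continuousOn_gDen ε isOpen_ball hd').aestronglyMeasurable measurableSet_ball)
      (Eventually.of_forall fun x => ?_)
    rw [Real.norm_of_nonneg (gDen_nonneg _ _ _)]
    linarith [hle x]
  · simp only [hb x hx, pow_one]
    exact mul_inv_cancel_left₀ ofReal_sqrt_two_ne_zero x

theorem AdmissiblePair.rescale {ε β : ℝ} (hβ : 1 ≤ β) {ψp ψm : ℂ → ℂ}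
    (h : AdmissiblePair ε β 1 1 ψp ψm) :
    AdmissibleScalar ε (fun y => (Real.sqrt 2 : ℂ) * ψp y) ∧
      AdmissibleScalar ε (fun y => (Real.sqrt 2 : ℂ) * ψm y) := by
  obtain ⟨hcp, hcm, hdp, hdm, hi, hb⟩ := h
  refine ⟨admissibleScalar_of_le hcp hdp hi (fun x => ?_) fun x hx => (hb x hx).1,
    admissibleScalar_of_le hcm hdm hi (fun x => ?_) fun x hx => (hb x hx).2⟩
  · linarith [average_gDen_le_eDen (ε := ε) hβ ψp ψm x,
      gDen_nonneg ε (fun y => (Real.sqrt 2 : ℂ) * ψm y) x]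
  · linarith [average_gDen_le_eDen (ε := ε) hβ ψp ψm x,
      gDen_nonneg ε (fun y => (Real.sqrt 2 : ℂ) * ψp y) x]

theorem admissibleScalar_id (ε : ℝ) : AdmissibleScalar ε (fun x => x) := by
  refine ⟨continuousOn_id, contDiffOn_id, ?_, fun _ _ => rfl⟩
  have h : ContinuousOn (gDen ε fun x => x) univ := continuousOn_gDen ε isOpen_univ contDiffOn_id
  exact ((h.mono (subset_univ _)).integrableOn_compact
    (isCompact_closedBall (0 : ℂ) 1)).mono_set ball_subset_closedBall

theorem IGL_le_Gn {ε : ℝ} {u : ℂ → ℂ} (hu : AdmissibleScalar ε u) : IGL ε ≤ Gn ε u := by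
  refine csInf_le ⟨0, ?_⟩ ⟨u, hu, rfl⟩
  rintro _ ⟨v, -, rfl⟩
  exact integral_nonneg (gDen_nonneg ε v)

theorem Ival_le_En {ε β : ℝ} (hβ : 0 ≤ β) {np nm : ℕ} {ψp ψm : ℂ → ℂ}
    (h : AdmissiblePair ε β np nm ψp ψm) : Ival ε β np nm ≤ En ε β ψp ψm := by
  refine csInf_le ⟨0, ?_⟩ ⟨ψp, ψm, h, rfl⟩
  rintro _ ⟨φp, φm, -, rfl⟩
  exact integral_nonneg (eDen_nonneg hβ φp φm)

theorem Ival_le_IGL (ε : ℝ) {β : ℝ} (hβ : 0 ≤ β) : Ival ε β 1 1 ≤ IGL ε := by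
  refine le_csInf ⟨_, _, admissibleScalar_id ε, rfl⟩ ?_
  rintro _ ⟨u, hu, rfl⟩
  refine (Ival_le_En hβ (hu.split β)).trans_eq ?_
  rw [En, eDen_split, Gn]

theorem IGL_le_Ival (ε : ℝ) {β : ℝ} (hβ : 1 ≤ β) : IGL ε ≤ Ival ε β 1 1 := by
  refine le_csInf ⟨_, _, _, (admissibleScalar_id ε).split β, rfl⟩ ?_
  rintro _ ⟨ψp, ψm, h, rfl⟩
  obtain ⟨hp, hm⟩ := h.rescale hβ
  have hle : ∫ x in ball (0 : ℂ) 1, (1 / 2) * (gDen ε (fun y => (Real.sqrt 2 : ℂ) * ψp y) x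
      + gDen ε (fun y => (Real.sqrt 2 : ℂ) * ψm y) x) ≤ En ε β ψp ψm :=
    integral_mono ((hp.2.2.1.add hm.2.2.1).const_mul (1 / 2)) h.2.2.2.2.1
      (average_gDen_le_eDen hβ ψp ψm)
  rw [integral_const_mul, integral_add hp.2.2.1 hm.2.2.1] at hle
  have h1 := IGL_le_Gn hp
  have h2 := IGL_le_Gn hm
  unfold Gn at h1 h2
  linarith

/-- For every `ε > 0` and `β > 0`, `I_{[1,1]}(ε;β) ≤ I_GL(ε)`; if moreover `β ≥ 1`,
then `I_{[1,1]}(ε;β) = I_GL(ε)`. -/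
theorem statement0 :
    ∀ ε > (0 : ℝ), ∀ β > (0 : ℝ),
      Ival ε β 1 1 ≤ IGL ε ∧ (1 ≤ β → Ival ε β 1 1 = IGL ε) := by
  intro ε _ β hβ
  exact ⟨Ival_le_IGL ε hβ.le, fun h => le_antisymm (Ival_le_IGL ε hβ.le) (IGL_le_Ival ε h)⟩
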